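/- In Version B, a position with exactly three piles is a P-position if and only if either all three pile sizes are even, or exactly one pile size is even and the other two are odd. -/

import Mathlib

/-- Remove one token from a pile of size `p` in `G`: delete one copy of `p` and,
if `p ≠ 1`, add back a pile of size `p - 1`. -/
def takeOne (G : Multiset ℕ) (p : ℕ) : Multiset ℕ :=
  G.erase p + (if p = 1 then (0 : Multiset ℕ) else {p - 1})

/-- Legal moves of Version B: remove one token from one chosen pile, or remove
one token from every pile simultaneously (piles reaching size 0 are deleted). -/
inductive MoveB : Multiset ℕ → Multiset ℕ → Prop
  | one {G : Multiset ℕ} {p : ℕ} (hp : p ∈ G) (h1 : 1 ≤ p) : MoveB G (takeOne G p)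
  | all {G : Multiset ℕ} (hG : G ≠ 0) : MoveB G ((G.map (· - 1)).filter (· ≠ 0))

mutual
  /-- P-positions of Version B under normal play: every move leads to an N-position
  (in particular the empty position is a P-position).  Since every move strictly
  decreases the total number of tokens, this inductive definition agrees with the
  usual recursive definition of outcome classes. -/
  inductive PPosB : Multiset ℕ → Prop
    | mk : ∀ {G : Multiset ℕ}, (∀ H, MoveB G H → NPosB H) → PPosB G
  /-- N-positions of Version B under normal play: some move leads to a P-position. -/
  inductive NPosB : Multiset ℕ → Prop
    | mk : ∀ {G H : Multiset ℕ}, MoveB G H → PPosB H → NPosB G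
end

theorem PPosB.not_nPosB {G : Multiset ℕ} (h : PPosB G) : ¬ NPosB G :=
  PPosB.rec (motive_1 := fun G _ => ¬ NPosB G) (motive_2 := fun G _ => ¬ PPosB G)
    (fun _ ih hN => by
      cases hN with
      | mk hm hP => exact ih _ hm hP)
    (fun hm _ ih hP => by
      cases hP with
      | mk hall => exact ih (hall _ hm))
    h

/-- The position obtained from a multiset of pile sizes by discarding the empty piles. -/
def nonemptyPiles (s : Multiset ℕ) : Multiset ℕ := s.filter (· ≠ 0)

theorem takeOne_nonemptyPiles_cons {a : ℕ} (ha : a ≠ 0) (s : Multiset ℕ) :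
    takeOne (nonemptyPiles (a ::ₘ s)) a = nonemptyPiles ((a - 1) ::ₘ s) := by
  unfold takeOne nonemptyPiles
  rw [Multiset.filter_cons_of_pos (p := (· ≠ 0)) _ ha, Multiset.erase_cons_head]
  split_ifs with h
  · simp [h]
  · rw [Multiset.filter_cons_of_pos (p := (· ≠ 0)) _ (show a - 1 ≠ 0 by omega), add_comm,
      Multiset.singleton_add]

theorem nonemptyPiles_map_pred (s : Multiset ℕ) :
    ((nonemptyPiles s).map (· - 1)).filter (· ≠ 0) = nonemptyPiles (s.map (· - 1)) := by
  unfold nonemptyPiles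
  induction s using Multiset.induction with
  | empty => simp
  | cons a s ih =>
    by_cases ha : a = 0
    · simpa [ha] using ih
    · rw [Multiset.filter_cons_of_pos (p := (· ≠ 0)) _ ha, Multiset.map_cons, Multiset.map_cons,
        Multiset.filter_cons, ih, ← Multiset.filter_cons (p := (· ≠ 0))]

theorem moveB_nonemptyPiles_cons {a : ℕ} (ha : a ≠ 0) (s : Multiset ℕ) :
    MoveB (nonemptyPiles (a ::ₘ s)) (nonemptyPiles ((a - 1) ::ₘ s)) := by
  rw [← takeOne_nonemptyPiles_cons ha]
  exact .one (by simp [nonemptyPiles, ha]) (by omega)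

theorem moveB_nonemptyPiles_map_pred {s : Multiset ℕ} (hs : ∃ p ∈ s, p ≠ 0) :
    MoveB (nonemptyPiles s) (nonemptyPiles (s.map (· - 1))) := by
  rw [← nonemptyPiles_map_pred]
  obtain ⟨p, hp, h0⟩ := hs
  refine .all fun h => ?_
  have : p ∈ nonemptyPiles s := Multiset.mem_filter.2 ⟨hp, h0⟩
  simp [h] at this

theorem MoveB.exists_of_nonemptyPiles {s H : Multiset ℕ} (h : MoveB (nonemptyPiles s) H) :
    (∃ p ∈ s, p ≠ 0 ∧ H = nonemptyPiles ((p - 1) ::ₘ s.erase p)) ∨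
      ((∃ p ∈ s, p ≠ 0) ∧ H = nonemptyPiles (s.map (· - 1))) := by
  cases h with
  | @one p hp h1 =>
    obtain ⟨hp, h0⟩ := Multiset.mem_filter.1 hp
    refine .inl ⟨p, hp, h0, ?_⟩
    rw [← takeOne_nonemptyPiles_cons h0, Multiset.cons_erase hp]
  | all hG =>
    obtain ⟨p, hp⟩ := Multiset.exists_mem_of_ne_zero hG
    exact .inr ⟨⟨p, Multiset.mem_filter.1 hp⟩, nonemptyPiles_map_pred s⟩

theorem insert_rotate {α : Type*} (a b c : α) : ({a, b, c} : Multiset α) = {b, c, a} := by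
  simp only [Multiset.insert_eq_cons, ← Multiset.singleton_add]
  abel

theorem MoveB.of_three_piles {a b c : ℕ} {H : Multiset ℕ}
    (h : MoveB (nonemptyPiles {a, b, c}) H) :
    (a ≠ 0 ∧ H = nonemptyPiles {a - 1, b, c}) ∨
      (b ≠ 0 ∧ H = nonemptyPiles {a, b - 1, c}) ∨
      (c ≠ 0 ∧ H = nonemptyPiles {a, b, c - 1}) ∨
      ((a ≠ 0 ∨ b ≠ 0 ∨ c ≠ 0) ∧ H = nonemptyPiles {a - 1, b - 1, c - 1}) := by
  rcases h.exists_of_nonemptyPiles with ⟨p, hp, h0, rfl⟩ | ⟨hp, rfl⟩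
  · have hp' : p = a ∨ p = b ∨ p = c := by simpa using hp
    rcases hp' with rfl | rfl | rfl
    · exact .inl ⟨h0, by simp⟩
    · refine .inr (.inl ⟨h0, ?_⟩)
      rw [insert_rotate a p c, insert_rotate a (p - 1) c]
      simp
    · refine .inr (.inr (.inl ⟨h0, ?_⟩))
      rw [← insert_rotate p a b, ← insert_rotate (p - 1) a b]
      simp
  · exact .inr (.inr (.inr ⟨by simpa using hp, by simp⟩))

/-- The three-pile P-positions, where piles of size `0` are allowed. -/
def IsThreePileP (a b c : ℕ) : Prop :=
  (Even a ∧ Even b ∧ Even c) ∨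
    (a ≠ 0 ∧ b ≠ 0 ∧ c ≠ 0 ∧
      ((Even a ∧ Odd b ∧ Odd c) ∨ (Odd a ∧ Even b ∧ Odd c) ∨ (Odd a ∧ Odd b ∧ Even c)))

theorem outcome_nonemptyPiles (n : ℕ) : ∀ a b c : ℕ, a + b + c = n →
    (IsThreePileP a b c → PPosB (nonemptyPiles {a, b, c})) ∧
      (¬ IsThreePileP a b c → NPosB (nonemptyPiles {a, b, c})) := by
  induction n using Nat.strong_induction_on with
  | _ n ih =>
  intro a b c hn
  have ihP {x y z : ℕ} (hlt : x + y + z < n) (h : IsThreePileP x y z) :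
      PPosB (nonemptyPiles {x, y, z}) := (ih _ hlt x y z rfl).1 h
  have ihN {x y z : ℕ} (hlt : x + y + z < n) (h : ¬ IsThreePileP x y z) :
      NPosB (nonemptyPiles {x, y, z}) := (ih _ hlt x y z rfl).2 h
  simp only [IsThreePileP, Nat.even_iff, Nat.odd_iff] at ihP ihN ⊢
  constructor
  · intro h
    refine .mk fun H hm => ?_
    rcases hm.of_three_piles with ⟨h0, rfl⟩ | ⟨h0, rfl⟩ | ⟨h0, rfl⟩ | ⟨h0, rfl⟩ <;>
      exact ihN (by omega) (by omega)
  · intro h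
    by_cases hall : (a - 1) % 2 = 0 ∧ (b - 1) % 2 = 0 ∧ (c - 1) % 2 = 0
    · have hm : MoveB (nonemptyPiles {a, b, c}) (nonemptyPiles {a - 1, b - 1, c - 1}) := by
        have h0 : a ≠ 0 ∨ b ≠ 0 ∨ c ≠ 0 := by omega
        simpa using moveB_nonemptyPiles_map_pred (s := {a, b, c}) (by simpa using h0)
      exact .mk hm (ihP (by omega) (.inl hall))
    · have key : (a % 2 = 1 ∧ b % 2 = 0 ∧ c % 2 = 0) ∨ (a % 2 = 0 ∧ b % 2 = 1 ∧ c % 2 = 0) ∨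
          (a % 2 = 0 ∧ b % 2 = 0 ∧ c % 2 = 1) := by omega
      rcases key with hk | hk | hk
      · exact .mk (moveB_nonemptyPiles_cons (by omega) {b, c}) (ihP (by omega) (by omega))
      · rw [insert_rotate]
        exact .mk (moveB_nonemptyPiles_cons (by omega) {c, a}) (ihP (by omega) (by omega))
      · rw [← insert_rotate]
        exact .mk (moveB_nonemptyPiles_cons (by omega) {a, b}) (ihP (by omega) (by omega))

/-- In Version B, a three-pile position is a P-position iff all three piles are even,
or exactly one pile is even and the other two are odd. -/
theorem versionB_three_piles (a b c : ℕ) (ha : 1 ≤ a) (hb : 1 ≤ b) (hc : 1 ≤ c) :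
    PPosB {a, b, c} ↔
      (Even a ∧ Even b ∧ Even c) ∨
      (Even a ∧ Odd b ∧ Odd c) ∨
      (Odd a ∧ Even b ∧ Odd c) ∨
      (Odd a ∧ Odd b ∧ Even c) := by
  have hG : nonemptyPiles {a, b, c} = {a, b, c} := by
    refine Multiset.filter_eq_self.2 fun p hp => ?_
    have : p = a ∨ p = b ∨ p = c := by simpa using hp
    omega
  have h := outcome_nonemptyPiles _ a b c rfl
  rw [hG] at h
  have hiff : PPosB {a, b, c} ↔ IsThreePileP a b c :=
    ⟨fun hP => by_contra fun hn => hP.not_nPosB (h.2 hn), h.1⟩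
  rw [hiff, IsThreePileP]
  simp only [Nat.even_iff, Nat.odd_iff]
  omega
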